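/- For a weakly C(4) finite monoid presentation ⟨A | R⟩: suppose a word u has an overlap prefix aXY and u = a·X·Y·u″. Then u ≡ v if and only if v = a·v′ for some word v′ with v′ ≡ X·Y·u″. -/

import Mathlib

open List

/-- A *relation word* is a word occurring as one side of some relation in `R`. -/
def RelWord {A : Type*} (R : Finset (List A × List A)) (w : List A) : Prop :=
  ∃ p ∈ R, w = p.1 ∨ w = p.2

/-- One elementary rewriting step using a defining relation (in either direction). -/
def OneStep {A : Type*} (R : Finset (List A × List A)) (u v : List A) : Prop :=
  ∃ l r x y, ((x, y) ∈ R ∨ (y, x) ∈ R) ∧ u = l ++ x ++ r ∧ v = l ++ y ++ r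

/-- `u ≡ v`: the congruence on the free monoid `A*` generated by the relations `R`. -/
def MEquiv {A : Type*} (R : Finset (List A × List A)) : List A → List A → Prop :=
  Relation.ReflTransGen (OneStep R)

/-- A *piece*: a word occurring as a factor of two distinct relation words, or in two
different (possibly overlapping) positions within one relation word.  The empty word
is a piece. -/
def Piece {A : Type*} (R : Finset (List A × List A)) (p : List A) : Prop :=
  p = [] ∨ ∃ r₁ r₂ a₁ b₁ a₂ b₂, RelWord R r₁ ∧ RelWord R r₂ ∧
    r₁ = a₁ ++ p ++ b₁ ∧ r₂ = a₂ ++ p ++ b₂ ∧ (r₁ ≠ r₂ ∨ a₁ ≠ a₂)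

/-- Weakly `C(n)`: no relation word is a product of strictly fewer than `n` pieces. -/
def WeaklyC {A : Type*} (R : Finset (List A × List A)) (n : ℕ) : Prop :=
  ∀ w, RelWord R w → ∀ L : List (List A), (∀ p ∈ L, Piece R p) → w = L.flatten →
    n ≤ L.length

/-- `X` is the maximal (longest) prefix of `r` which is a piece. -/
def MaxPiecePrefix {A : Type*} (R : Finset (List A × List A)) (r X : List A) : Prop :=
  X <+: r ∧ Piece R X ∧ ∀ p, p <+: r → Piece R p → p.length ≤ X.length

/-- `Z` is the maximal (longest) suffix of `r` which is a piece. -/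
def MaxPieceSuffix {A : Type*} (R : Finset (List A × List A)) (r Z : List A) : Prop :=
  Z <:+ r ∧ Piece R Z ∧ ∀ s, s <:+ r → Piece R s → s.length ≤ Z.length

/-- `X ++ Y ++ Z` is a relation word with maximal piece prefix `X`, middle word `Y`
and maximal piece suffix `Z`. -/
def RelDecomp {A : Type*} (R : Finset (List A × List A)) (X Y Z : List A) : Prop :=
  RelWord R (X ++ Y ++ Z) ∧ MaxPiecePrefix R (X ++ Y ++ Z) X ∧
    MaxPieceSuffix R (X ++ Y ++ Z) Z

/-- `q` is a relation prefix of `u`: a prefix of the form `a ++ X ++ Y` where `X`, `Y`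
are the maximal piece prefix and middle word of some relation word `X ++ Y ++ Z`. -/
def RelPrefix {A : Type*} (R : Finset (List A × List A)) (u q : List A) : Prop :=
  q <+: u ∧ ∃ a X Y Z, q = a ++ X ++ Y ∧ RelDecomp R X Y Z

/-- `a ++ X ++ Y` is an overlap prefix of `u`, with final maximal piece prefix `X` and
middle word `Y`, i.e. it admits a factorisation `b X₁ Y₁' ⋯ X_{n-1} Y_{n-1}' X_n Y_n`
with `X = X_n`, `Y = Y_n`, no factor `X₀ Y₀` beginning strictly before the end of `b`,
each `X_i Y_i Z_i` a relation word factored into maximal piece prefix, middle word and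
maximal piece suffix, and each `Y_i'` (`i < n`) a proper non-empty prefix of `Y_i`. -/
def OPrefix {A : Type*} (R : Finset (List A × List A)) (u a X Y : List A) : Prop :=
  (a ++ X ++ Y) <+: u ∧
  ∃ (b : List A) (n : ℕ) (Xs Ys Zs Ys' : ℕ → List A),
    1 ≤ n ∧ Xs (n - 1) = X ∧ Ys (n - 1) = Y ∧
    a = b ++ ((List.range (n - 1)).map fun i => Xs i ++ Ys' i).flatten ∧
    (∀ i < n, RelDecomp R (Xs i) (Ys i) (Zs i)) ∧
    (∀ i < n - 1, Ys' i ≠ [] ∧ Ys' i <+: Ys i ∧ Ys' i ≠ Ys i) ∧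
    ¬ ∃ c d X₀ Y₀ Z₀, RelDecomp R X₀ Y₀ Z₀ ∧
        a ++ X ++ Y = c ++ X₀ ++ Y₀ ++ d ∧ c.length < b.length

/-- The relation prefix `a ++ X ++ Y` of `u` is *clean*: `u` has no prefix
`a ++ X ++ Y₀ ++ X₁ ++ Y₁` with `Y₀` a proper non-empty prefix of `Y` and `X₁`, `Y₁`
the maximal piece prefix and middle word of some relation word. -/
def CleanAt {A : Type*} (R : Finset (List A × List A)) (u a X Y : List A) : Prop :=
  ¬ ∃ Y₀ X₁ Y₁ Z₁, RelDecomp R X₁ Y₁ Z₁ ∧ Y₀ ≠ [] ∧ Y₀ <+: Y ∧ Y₀ ≠ Y ∧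
      (a ++ X ++ Y₀ ++ X₁ ++ Y₁) <+: u

/-- `a ++ X ++ Y` is a clean overlap prefix of `u`, where `X ++ Y ++ Z` is a relation
word with maximal piece prefix `X`, middle word `Y` and maximal piece suffix `Z`. -/
def CleanOverlapPrefix {A : Type*} (R : Finset (List A × List A))
    (u a X Y Z : List A) : Prop :=
  RelDecomp R X Y Z ∧ OPrefix R u a X Y ∧ CleanAt R u a X Y

/-- `r'` is a complement of the relation word `r`: there is a chain of relation words
from `r` to `r'` each consecutive pair of which forms a relation (in some order). -/
def RelComplement {A : Type*} (R : Finset (List A × List A)) (r r' : List A) : Prop :=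
  RelWord R r ∧ Relation.ReflTransGen (fun s t => (s, t) ∈ R ∨ (t, s) ∈ R) r r'

/-- `u` is `p`-active: `p ++ u` has a relation prefix `a ++ X ++ Y` with `|a| < |p|`. -/
def PActive {A : Type*} (R : Finset (List A × List A)) (p u : List A) : Prop :=
  ∃ a X Y Z, RelDecomp R X Y Z ∧ (a ++ X ++ Y) <+: (p ++ u) ∧ a.length < p.length

/-- `p` is a possible prefix of `u`: `p ++ w ≡ u` for some word `w`. -/
def PossPrefix {A : Type*} (R : Finset (List A × List A)) (p u : List A) : Prop :=
  ∃ w, MEquiv R (p ++ w) u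

section OverlapChains

variable {A : Type*} {R : Finset (List A × List A)}

theorem piece_nil : Piece R [] := Or.inl rfl

theorem piece_of_occurrences {r₁ r₂ p : List A} (a₁ b₁ a₂ b₂ : List A) (h₁ : RelWord R r₁)
    (h₂ : RelWord R r₂) (e₁ : r₁ = a₁ ++ p ++ b₁) (e₂ : r₂ = a₂ ++ p ++ b₂)
    (h : r₁ ≠ r₂ ∨ a₁ ≠ a₂) : Piece R p :=
  Or.inr ⟨r₁, r₂, a₁, b₁, a₂, b₂, h₁, h₂, e₁, e₂, h⟩

theorem Piece.of_isInfix {p q : List A} (hp : Piece R p) (hq : q <:+: p) : Piece R q := by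
  obtain ⟨s, t, rfl⟩ := hq
  rcases hp with hp | ⟨r₁, r₂, a₁, b₁, a₂, b₂, h₁, h₂, e₁, e₂, h⟩
  · simp at hp
    exact Or.inl hp.2.1
  · refine piece_of_occurrences (a₁ ++ s) (t ++ b₁) (a₂ ++ s) (t ++ b₂) h₁ h₂
      (by simp [e₁]) (by simp [e₂]) ?_
    simpa using h

theorem WeaklyC.not_piece_append (hC : WeaklyC R 4) {p q : List A}
    (hp : Piece R p) (hq : Piece R q) : ¬ RelWord R (p ++ q) := fun h => by
  have := hC _ h [p, q] (by simp [hp, hq]) (by simp)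
  simp at this

theorem WeaklyC.not_piece (hC : WeaklyC R 4) {w : List A} (h : RelWord R w) : ¬ Piece R w :=
  fun hp => hC.not_piece_append hp piece_nil (by simpa using h)

theorem WeaklyC.middle_not_piece (hC : WeaklyC R 4) {X Y Z : List A} (h : RelDecomp R X Y Z) :
    ¬ Piece R Y := fun hY => by
  have := hC _ h.1 [X, Y, Z] (by simp [hY, h.2.1.2.1, h.2.2.2.1]) (by simp)
  simp at this

theorem WeaklyC.middle_ne_nil (hC : WeaklyC R 4) {X Y Z : List A} (h : RelDecomp R X Y Z) :
    Y ≠ [] := by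
  rintro rfl
  exact hC.middle_not_piece h piece_nil

/-- Extending the maximal piece prefix by a nonempty prefix of the middle word gives a word
that is not a piece. -/
theorem RelDecomp.not_piece_append {X Y Z Y' : List A} (h : RelDecomp R X Y Z) (hne : Y' ≠ [])
    (hY : Y' <+: Y) : ¬ Piece R (X ++ Y') := fun hp => by
  obtain ⟨Y'', rfl⟩ := hY
  have := h.2.1.2.2 (X ++ Y') ⟨Y'' ++ Z, by simp⟩ hp
  exact hne (by simpa using this)

theorem exists_maxPiecePrefix (r : List A) : ∃ X, MaxPiecePrefix R r X := by
  classical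
  obtain ⟨X, hX, hm⟩ := (r.inits.toFinset.filter (Piece R)).exists_max_image List.length
    ⟨[], by simp [piece_nil]⟩
  simp only [Finset.mem_filter, List.mem_toFinset, List.mem_inits] at hX hm
  exact ⟨X, hX.1, hX.2, fun p h₁ h₂ => hm p ⟨h₁, h₂⟩⟩

theorem exists_maxPieceSuffix (r : List A) : ∃ Z, MaxPieceSuffix R r Z := by
  classical
  obtain ⟨Z, hZ, hm⟩ := (r.tails.toFinset.filter (Piece R)).exists_max_image List.length
    ⟨[], by simp [piece_nil]⟩
  simp only [Finset.mem_filter, List.mem_toFinset, List.mem_tails] at hZ hm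
  exact ⟨Z, hZ.1, hZ.2, fun p h₁ h₂ => hm p ⟨h₁, h₂⟩⟩

theorem WeaklyC.exists_relDecomp (hC : WeaklyC R 4) {r : List A} (hr : RelWord R r) :
    ∃ X Y Z, RelDecomp R X Y Z ∧ r = X ++ Y ++ Z := by
  obtain ⟨X, hX⟩ := exists_maxPiecePrefix (R := R) r
  obtain ⟨Z, hZ⟩ := exists_maxPieceSuffix (R := R) r
  obtain ⟨s, hs⟩ := hX.1
  obtain ⟨t, ht⟩ := hZ.1
  rcases List.append_eq_append_iff.1 (hs.trans ht.symm) with ⟨Y, hY, -⟩ | ⟨m, -, rfl⟩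
  · have e : r = X ++ Y ++ Z := by rw [← ht, hY]
    subst e
    exact ⟨X, Y, Z, ⟨hr, hX, hZ⟩, rfl⟩
  · exact absurd (hs ▸ hr)
      (hC.not_piece_append hX.2.1 (hZ.2.1.of_isInfix (List.suffix_append m s).isInfix))

/-- A word `X₁ Y₁' X₂ Y₂' ⋯ Xₙ Yₙ s` where each `Xᵢ Yᵢ` comes from a relation word and each
`Yᵢ'` is a proper nonempty prefix of `Yᵢ`. -/
inductive OverlapChain (R : Finset (List A × List A)) : List A → Prop
  | full {X Y Z : List A} (s : List A) (h : RelDecomp R X Y Z) : OverlapChain R (X ++ Y ++ s)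
  | link {X Y Z Y' w : List A} (h : RelDecomp R X Y Z) (hne : Y' ≠ []) (hY : Y' <+: Y)
      (hY' : Y' ≠ Y) (hw : OverlapChain R w) : OverlapChain R (X ++ Y' ++ w)

theorem OverlapChain.exists_head (hC : WeaklyC R 4) {w : List A} (hw : OverlapChain R w) :
    ∃ X Y Z Y' s, RelDecomp R X Y Z ∧ Y' ≠ [] ∧ Y' <+: Y ∧ w = X ++ Y' ++ s := by
  cases hw with
  | @full X Y Z s h =>
    exact ⟨X, Y, Z, Y, s, h, hC.middle_ne_nil h, List.prefix_rfl, rfl⟩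
  | @link X Y Z Y' w h hne hY hY' hw => exact ⟨X, Y, Z, Y', w, h, hne, hY, rfl⟩

/-- A relation word starting strictly before an overlap chain meets the chain in a piece. -/
theorem OverlapChain.prefix_or_append_piece (hC : WeaklyC R 4) {w l t : List A}
    (hw : OverlapChain R w) (hl : l ≠ []) (ht : RelWord R t) (h : t <+: l ++ w) :
    t <+: l ∨ ∃ q, t = l ++ q ∧ Piece R q := by
  obtain ⟨X, Y, Z, Y', s, hd, hne, ⟨Y'', rfl⟩, rfl⟩ := hw.exists_head hC
  rcases List.prefix_or_prefix_of_prefix h (List.prefix_append l _) with h' | ⟨q, rfl⟩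
  · exact Or.inl h'
  refine Or.inr ⟨q, rfl, ?_⟩
  rw [List.prefix_append_right_inj] at h
  rcases List.prefix_or_prefix_of_prefix h (List.prefix_append (X ++ Y') s) with ⟨m, hm⟩ | ⟨m, rfl⟩
  · refine piece_of_occurrences l [] [] (m ++ Y'' ++ Z) ht hd.1 (by simp) ?_ (Or.inr hl)
    simp [← List.append_assoc, hm]
  · refine absurd ?_ (hd.not_piece_append hne (List.prefix_append _ _))
    exact piece_of_occurrences l m [] (Y'' ++ Z) ht hd.1 (by simp) (by simp) (Or.inr hl)

/-- Either `l` begins with `p`, or `l` is a proper prefix of `p` and what follows `l`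
overlaps `p`. -/
theorem append_eq_append_cases {p w l t r : List A} (h : p ++ w = l ++ t ++ r) :
    (∃ l', l = p ++ l' ∧ w = l' ++ t ++ r) ∨ ∃ m, m ≠ [] ∧ p = l ++ m ∧ t <+: m ++ w := by
  rw [List.append_assoc l] at h
  rcases List.append_eq_append_iff.1 h with ⟨l', rfl, e⟩ | ⟨m, rfl, e⟩
  · exact Or.inl ⟨l', rfl, by simpa using e⟩
  · by_cases hm : m = []
    · subst hm
      exact Or.inl ⟨[], by simp, by simpa using e.symm⟩
    · exact Or.inr ⟨m, hm, rfl, ⟨r, e⟩⟩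

/-- Every rewriting step on `p ++ w`, with `w` an overlap chain, takes place inside `w`. -/
def StepInert (R : Finset (List A × List A)) (p : List A) : Prop :=
  ∀ w v, OverlapChain R w → OneStep R (p ++ w) v → ∃ w', v = p ++ w' ∧ OneStep R w w'

theorem OneStep.relWord_left {x y : List A} (h : (x, y) ∈ R ∨ (y, x) ∈ R) : RelWord R x :=
  h.elim (fun h => ⟨_, h, Or.inl rfl⟩) fun h => ⟨_, h, Or.inr rfl⟩

theorem stepInert_of_not_overlap {p : List A}
    (h : ∀ w l m t, OverlapChain R w → RelWord R t → m ≠ [] → p = l ++ m → ¬ t <+: m ++ w) :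
    StepInert R p := by
  rintro w v hw ⟨l, r, x, y, hxy, hu, rfl⟩
  rcases append_eq_append_cases hu with ⟨l', rfl, rfl⟩ | ⟨m, hm, hp, ht⟩
  · exact ⟨l' ++ y ++ r, by simp, l', r, x, y, hxy, rfl, rfl⟩
  · exact absurd ht (h w l m x hw (OneStep.relWord_left hxy) hm hp)

theorem WeaklyC.stepInert_link (hC : WeaklyC R 4) {X Y Z Y' : List A} (h : RelDecomp R X Y Z)
    (hne : Y' ≠ []) (hY : Y' <+: Y) (hY' : Y' ≠ Y) : StepInert R (X ++ Y') := by
  refine stepInert_of_not_overlap fun w l m t hw ht hm hp hpre => ?_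
  have hXY := h.not_piece_append hne hY
  obtain ⟨Y'', rfl⟩ := hY
  have hY'' : Y'' ≠ [] := by
    rintro rfl
    simp at hY'
  have hlen := List.length_pos_of_ne_nil hY''
  have hr : X ++ (Y' ++ Y'') ++ Z = l ++ m ++ (Y'' ++ Z) := by simp [← hp]
  rcases hw.prefix_or_append_piece hC hm ht hpre with ⟨n, rfl⟩ | ⟨q, rfl, hq⟩
  · refine hC.not_piece ht (piece_of_occurrences [] [] l (n ++ Y'' ++ Z) ht h.1 (by simp)
      (by simp [hr]) (Or.inl fun e => ?_))
    have := congrArg List.length (e.trans hr)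
    simp at this
    omega
  · by_cases hl : l = []
    · subst hl
      obtain rfl : X ++ Y' = m := by simpa using hp
      by_cases e : X ++ Y' ++ q = X ++ (Y' ++ Y'') ++ Z
      · obtain rfl : q = Y'' ++ Z := by simpa using e
        have := h.2.2.2.2 (Y'' ++ Z) ⟨X ++ Y', by simp⟩ hq
        exact hY'' (by simpa using this)
      · exact hXY (piece_of_occurrences [] q [] (Y'' ++ Z) ht h.1 (by simp) (by simp) (Or.inl e))
    · exact hC.not_piece_append (piece_of_occurrences [] q l (Y'' ++ Z) ht h.1 (by simp) hr
        (Or.inr (Ne.symm hl))) hq ht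

theorem WeaklyC.stepInert_of_no_factor (hC : WeaklyC R 4) {b : List A}
    (hb : ∀ X Y Z, RelDecomp R X Y Z → ¬ (X ++ Y) <:+: b) : StepInert R b := by
  refine stepInert_of_not_overlap fun w l m t hw ht hm hp hpre => ?_
  obtain ⟨X, Y, Z, hd, rfl⟩ := hC.exists_relDecomp ht
  refine hb X Y Z hd ?_
  subst hp
  suffices X ++ Y <+: m from this.isInfix.trans (List.suffix_append l m).isInfix
  rcases hw.prefix_or_append_piece hC hm ht hpre with h | ⟨q, e, hq⟩
  · exact (List.prefix_append _ Z).trans h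
  · have := hd.2.2.2.2 q ⟨m, e.symm⟩ hq
    refine List.prefix_of_prefix_length_le (List.prefix_append (X ++ Y) Z) ⟨q, e.symm⟩ ?_
    have := congrArg List.length e
    simp at this ⊢
    omega

theorem WeaklyC.overlapChain_append (hC : WeaklyC R 4) {t : List A} (ht : RelWord R t)
    (s : List A) : OverlapChain R (t ++ s) := by
  obtain ⟨X, Y, Z, h, rfl⟩ := hC.exists_relDecomp ht
  rw [List.append_assoc _ Z s]
  exact .full _ h

theorem OverlapChain.oneStep (hC : WeaklyC R 4) {w v : List A} (hw : OverlapChain R w)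
    (hs : OneStep R w v) : OverlapChain R v := by
  induction hw generalizing v with
  | @link X Y Z Y' w h hne hY hY' hw ih =>
    obtain ⟨w', rfl, hs'⟩ := hC.stepInert_link h hne hY hY' w v hw hs
    exact .link h hne hY hY' (ih hs')
  | @full X Y Z s h =>
    obtain ⟨l, r, x, y, hxy, hu, rfl⟩ := hs
    have hx := OneStep.relWord_left hxy
    have hy := OneStep.relWord_left hxy.symm
    rcases append_eq_append_cases hu with ⟨l', rfl, rfl⟩ | ⟨m, hm, hp, hpre⟩
    · rw [List.append_assoc _ y r, List.append_assoc _ l']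
      exact .full _ h
    by_cases hl : l = []
    · subst hl
      exact hC.overlapChain_append hy r
    rcases List.prefix_or_prefix_of_prefix hpre (List.prefix_append m s) with ⟨n, rfl⟩ | ⟨n, rfl⟩
    · refine absurd ?_ (hC.not_piece hx)
      exact piece_of_occurrences [] [] l (n ++ Z) hx h.1 (by simp) (by simp [hp]) (Or.inr (Ne.symm hl))
    have hmp : Piece R m :=
      piece_of_occurrences [] n l Z hx h.1 (by simp) (by simp [hp]) (Or.inr (Ne.symm hl))
    rcases List.append_eq_append_iff.1 hp with ⟨Y', rfl, rfl⟩ | ⟨k, -, rfl⟩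
    · rw [List.append_assoc _ y r]
      refine .link h ?_ (List.prefix_append _ _) (by simpa using hm) (hC.overlapChain_append hy r)
      rintro rfl
      exact hC.middle_not_piece h hmp
    · exact absurd (hmp.of_isInfix (List.suffix_append k Y).isInfix) (hC.middle_not_piece h)

theorem OneStep.symm {u v : List A} (h : OneStep R u v) : OneStep R v u := by
  obtain ⟨l, r, x, y, hxy, hu, hv⟩ := h
  exact ⟨l, r, y, x, hxy.symm, hv, hu⟩

theorem MEquiv.symm {u v : List A} (h : MEquiv R u v) : MEquiv R v u :=
  have : Std.Symm (OneStep R) := ⟨fun _ _ => OneStep.symm⟩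
  Relation.ReflTransGen.stdSymm.symm _ _ h

theorem MEquiv.append_left (a : List A) {u v : List A} (h : MEquiv R u v) :
    MEquiv R (a ++ u) (a ++ v) := by
  refine Relation.ReflTransGen.lift (a ++ ·) ?_ _ _ h
  rintro _ _ ⟨l, r, x, y, hxy, rfl, rfl⟩
  exact ⟨a ++ l, r, x, y, hxy, by simp, by simp⟩

theorem StepInert.append {p q : List A} (hp : StepInert R p) (hq : StepInert R q)
    (hch : ∀ w, OverlapChain R w → OverlapChain R (q ++ w)) : StepInert R (p ++ q) := by
  intro w v hw hs
  rw [List.append_assoc] at hs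
  obtain ⟨w₁, rfl, hs₁⟩ := hp _ _ (hch w hw) hs
  obtain ⟨w₂, rfl, hs₂⟩ := hq _ _ hw hs₁
  exact ⟨w₂, by simp, hs₂⟩

theorem stepInert_flatten {L : List (List A)}
    (hL : ∀ p ∈ L, StepInert R p ∧ ∀ w, OverlapChain R w → OverlapChain R (p ++ w)) :
    StepInert R L.flatten ∧ ∀ w, OverlapChain R w → OverlapChain R (L.flatten ++ w) := by
  induction L with
  | nil => exact ⟨fun w v _ hs => ⟨v, rfl, hs⟩, fun w hw => hw⟩
  | cons p L ih =>
    obtain ⟨h₁, h₂⟩ := List.forall_mem_cons.1 hL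
    obtain ⟨i₁, i₂⟩ := ih h₂
    refine ⟨h₁.1.append i₁ i₂, fun w hw => ?_⟩
    rw [List.flatten_cons, List.append_assoc]
    exact h₁.2 _ (i₂ _ hw)

theorem StepInert.mequiv (hC : WeaklyC R 4) {p w v : List A} (hp : StepInert R p)
    (hw : OverlapChain R w) (h : MEquiv R (p ++ w) v) : ∃ w', v = p ++ w' ∧ MEquiv R w w' := by
  suffices ∃ w', v = p ++ w' ∧ MEquiv R w w' ∧ OverlapChain R w' by
    obtain ⟨w', h₁, h₂, -⟩ := this
    exact ⟨w', h₁, h₂⟩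
  induction h with
  | refl => exact ⟨w, rfl, .refl, hw⟩
  | tail _ hs ih =>
    obtain ⟨w₁, rfl, h₁, hw₁⟩ := ih
    obtain ⟨w₂, rfl, h₂⟩ := hp _ _ hw₁ hs
    exact ⟨w₂, rfl, h₁.tail h₂, hw₁.oneStep hC h₂⟩

theorem OPrefix.stepInert (hC : WeaklyC R 4) {u a X Y : List A} (h : OPrefix R u a X Y) :
    StepInert R a ∧ ∃ Z, RelDecomp R X Y Z := by
  obtain ⟨-, b, n, Xs, Ys, Zs, Ys', hn, rfl, rfl, rfl, hd, hY, hb⟩ := h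
  refine ⟨?_, Zs (n - 1), hd _ (by omega)⟩
  have hL := stepInert_flatten (R := R)
    (L := (List.range (n - 1)).map fun i => Xs i ++ Ys' i) (by
      simp only [List.mem_map, List.mem_range]
      rintro _ ⟨i, hi, rfl⟩
      obtain ⟨h₁, h₂, h₃⟩ := hY i hi
      have hi' := hd i (by omega)
      exact ⟨hC.stepInert_link hi' h₁ h₂ h₃, fun w hw => .link hi' h₁ h₂ h₃ hw⟩)
  refine (hC.stepInert_of_no_factor fun X₀ Y₀ Z₀ h₀ => ?_).append hL.1 hL.2
  rintro ⟨c, d, rfl⟩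
  have := List.length_pos_of_ne_nil (hC.middle_ne_nil h₀)
  refine hb ⟨c, d ++ (((List.range (n - 1)).map fun i => Xs i ++ Ys' i).flatten ++
    (Xs (n - 1) ++ Ys (n - 1))), X₀, Y₀, Z₀, h₀, by simp only [List.append_assoc], ?_⟩
  simp only [List.length_append]
  omega

end OverlapChains

/-- Proposition 7: for a weakly `C(4)` finite monoid presentation,
suppose a word `u` has an overlap prefix `a ++ X ++ Y` and `u = a ++ X ++ Y ++ u''`.
Then `u ≡ v` if and only if `v = a ++ v'` for some `v'` with `v' ≡ X ++ Y ++ u''`. -/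
theorem overlapPrefix_equiv_iff {A : Type*} [Fintype A] [DecidableEq A]
    (R : Finset (List A × List A)) (hC : WeaklyC R 4)
    (u a X Y u'' v : List A) (hop : OPrefix R u a X Y)
    (hu : u = a ++ X ++ Y ++ u'') :
    MEquiv R u v ↔ ∃ v', v = a ++ v' ∧ MEquiv R v' (X ++ Y ++ u'') := by
  subst hu
  obtain ⟨ha, Z, hd⟩ := hop.stepInert hC
  constructor
  · intro h
    rw [List.append_assoc a X, List.append_assoc a] at h
    obtain ⟨v', rfl, h'⟩ := ha.mequiv hC (.full u'' hd) h
    exact ⟨v', rfl, h'.symm⟩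
  · rintro ⟨v', rfl, h⟩
    rw [List.append_assoc a X, List.append_assoc a]
    exact h.symm.append_left a
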